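/- Let k and ℓ be natural numbers with ℓ ≤ k. In the monoid algebra MonoidAlgebra ℚ (Equiv.Perm (Fin k)), the product of the element ∑_{τ} τ, where τ ranges over all (k,ℓ)-shuffles of Fin k, with the element (1/(ℓ! · (k−ℓ)!)) • ∑_{ρ} ρ, where ρ ranges over all (k,ℓ)-block permutations of Fin k, equals (k choose ℓ) • ((1/k!) • ∑_{σ} σ), where σ ranges over all permutations of Fin k. -/

import Mathlib

/-- A (k,ℓ)-shuffle: a permutation of `Fin k` strictly monotone on the first `ℓ`
indices and strictly monotone on the remaining indices. -/
def IsShuffle (k ℓ : ℕ) (τ : Equiv.Perm (Fin k)) : Prop :=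
  StrictMonoOn τ {i : Fin k | (i : ℕ) < ℓ} ∧ StrictMonoOn τ {i : Fin k | ℓ ≤ (i : ℕ)}

/-- A (k,ℓ)-unshuffle: the inverse of a (k,ℓ)-shuffle. -/
def IsUnshuffle (k ℓ : ℕ) (τ : Equiv.Perm (Fin k)) : Prop :=
  IsShuffle k ℓ τ⁻¹

/-- A (k,ℓ)-block permutation: a permutation of `Fin k` mapping the set of the
first `ℓ` indices onto itself. -/
def IsBlockPerm (k ℓ : ℕ) (ρ : Equiv.Perm (Fin k)) : Prop :=
  ⇑ρ '' {i : Fin k | (i : ℕ) < ℓ} = {i : Fin k | (i : ℕ) < ℓ}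


def shKey (k ℓ : ℕ) (σ : Equiv.Perm (Fin k)) (i : Fin k) : ℕ ×ₗ Fin k :=
  toLex (if (i : ℕ) < ℓ then 0 else 1, σ i)

theorem shKey_inj (k ℓ : ℕ) (σ : Equiv.Perm (Fin k)) : Function.Injective (shKey k ℓ σ) := by
  intro a b hab
  have := congrArg (fun x => (ofLex x).2) hab
  exact σ.injective this

theorem shKey_lt (k ℓ : ℕ) (σ : Equiv.Perm (Fin k)) (i j : Fin k) :
    shKey k ℓ σ i < shKey k ℓ σ j ↔
      ((i : ℕ) < ℓ ∧ ℓ ≤ (j : ℕ)) ∨ (((i : ℕ) < ℓ ↔ (j : ℕ) < ℓ) ∧ σ i < σ j) := by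
  unfold shKey
  rw [Prod.Lex.toLex_lt_toLex]
  dsimp only
  split_ifs <;> simp <;> omega

theorem isBlockPerm_iff (k ℓ : ℕ) (ρ : Equiv.Perm (Fin k)) :
    IsBlockPerm k ℓ ρ ↔ ∀ i, ((ρ i : ℕ) < ℓ ↔ (i : ℕ) < ℓ) := by
  unfold IsBlockPerm
  constructor
  · intro h i
    have h1 : ρ i ∈ ρ '' {i : Fin k | (i : ℕ) < ℓ} ↔ i ∈ {i : Fin k | (i : ℕ) < ℓ} :=
      ρ.injective.mem_set_image
    rw [h] at h1
    exact h1
  · intro h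
    ext x
    constructor
    · rintro ⟨y, hy, rfl⟩
      exact (h y).2 hy
    · intro hx
      refine ⟨ρ.symm x, ?_, by simp⟩
      apply (h _).1
      simpa using hx

theorem key_strictMono (k ℓ : ℕ) (σ π : Equiv.Perm (Fin k))
    (h : StrictMono (shKey k ℓ σ ∘ π)) : ∀ i, ((π i : ℕ) < ℓ ↔ (i : ℕ) < ℓ) := by
  have key : ∀ i j, i ≤ j → (π j : ℕ) < ℓ → (π i : ℕ) < ℓ := by
    intro i j hij hj
    rcases hij.eq_or_lt with rfl | hij
    · exact hj
    · have := (shKey_lt k ℓ σ _ _).1 (h hij)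
      omega
  intro i
  constructor
  · intro hi
    have := Finset.card_le_card_of_injOn (s := Finset.Iic i) (t := Finset.range ℓ)
      (fun j => (π j : ℕ)) (by
        intro j hj
        simp at hj ⊢
        exact key _ _ hj hi) (by
        intro a _ b _ hab
        exact π.injective (Fin.ext hab))
    simp at this
    omega
  · intro hi
    by_contra hc
    have := Finset.card_le_card_of_injOn (s := Finset.Ici i) (t := Finset.Ico ℓ k)
      (fun j => (π j : ℕ)) (by
        intro j hj
        simp at hj ⊢
        by_contra hlt
        exact hc (key _ _ hj (by omega))) (by
        intro a _ b _ hab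
        exact π.injective (Fin.ext hab))
    simp at this
    have := i.2
    omega

theorem strictMono_iff (k ℓ : ℕ) (σ π : Equiv.Perm (Fin k)) :
    StrictMono (shKey k ℓ σ ∘ π) ↔ IsBlockPerm k ℓ π ∧ IsShuffle k ℓ (σ * π) := by
  rw [isBlockPerm_iff]
  constructor
  · intro h
    have hb := key_strictMono k ℓ σ π h
    refine ⟨hb, ?_, ?_⟩
    all_goals
      intro i hi j hj hij
      have := (shKey_lt k ℓ σ _ _).1 (h hij)
      simp only [Set.mem_ofPred_eq] at hi hj
      have h1 := hb i
      have h2 := hb j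
      rcases this with h3 | h3
      · omega
      · exact h3.2
  · rintro ⟨hb, h1, h2⟩ i j hij
    refine (shKey_lt k ℓ σ _ _).2 ?_
    rw [hb i, hb j]
    have hij' : (i : ℕ) < j := hij
    by_cases hi : (i : ℕ) < ℓ <;> by_cases hj : (j : ℕ) < ℓ
    · exact Or.inr ⟨by omega, h1 hi hj hij⟩
    · exact Or.inl ⟨hi, by have := hb j; omega⟩
    · omega
    · exact Or.inr ⟨by omega, h2 (not_lt.1 hi) (not_lt.1 hj) hij⟩

theorem sort_iff (k ℓ : ℕ) (σ π : Equiv.Perm (Fin k)) :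
    π = Tuple.sort (shKey k ℓ σ) ↔ IsBlockPerm k ℓ π ∧ IsShuffle k ℓ (σ * π) := by
  rw [← strictMono_iff, Tuple.eq_sort_iff]
  have hinj : Function.Injective (shKey k ℓ σ ∘ π) := (shKey_inj k ℓ σ).comp π.injective
  constructor
  · intro h
    exact h.1.strictMono_of_injective hinj
  · intro h
    refine ⟨h.monotone, fun i j hij he => ?_⟩
    exact absurd (hinj he) hij.ne

theorem isBlockPerm_inv (k ℓ : ℕ) (ρ : Equiv.Perm (Fin k)) (h : IsBlockPerm k ℓ ρ) :
    IsBlockPerm k ℓ ρ⁻¹ := by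
  rw [isBlockPerm_iff] at *
  intro i
  rw [← h (ρ⁻¹ i)]
  simp

open scoped Classical in
/-- Group-algebra form of the second diagram of Lemma A.2: the sum over
shuffles times the partial symmetrizer equals `(k choose ℓ)` times the full
symmetrizer. -/
theorem shuffleSum_mul_partialSymmetrizer (k ℓ : ℕ) (h : ℓ ≤ k) :
    ((∑ τ ∈ Finset.univ.filter (fun τ => IsShuffle k ℓ τ),
        MonoidAlgebra.of ℚ (Equiv.Perm (Fin k)) τ) *
      (((1 : ℚ) / (Nat.factorial ℓ * Nat.factorial (k - ℓ))) •
        ∑ ρ ∈ Finset.univ.filter (fun ρ => IsBlockPerm k ℓ ρ),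
          MonoidAlgebra.of ℚ (Equiv.Perm (Fin k)) ρ)) =
    (k.choose ℓ) • (((1 : ℚ) / (Nat.factorial k)) •
      ∑ σ : Equiv.Perm (Fin k), MonoidAlgebra.of ℚ (Equiv.Perm (Fin k)) σ) := by
  have main : (∑ τ ∈ Finset.univ.filter (fun τ => IsShuffle k ℓ τ),
        MonoidAlgebra.of ℚ (Equiv.Perm (Fin k)) τ) *
        (∑ ρ ∈ Finset.univ.filter (fun ρ => IsBlockPerm k ℓ ρ),
          MonoidAlgebra.of ℚ (Equiv.Perm (Fin k)) ρ) =
      ∑ σ : Equiv.Perm (Fin k), MonoidAlgebra.of ℚ (Equiv.Perm (Fin k)) σ := by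
    rw [Finset.sum_mul_sum, ← Finset.sum_product']
    have uniq : ∀ τ ρ : Equiv.Perm (Fin k), IsShuffle k ℓ τ → IsBlockPerm k ℓ ρ →
        ρ⁻¹ = Tuple.sort (shKey k ℓ (τ * ρ)) := by
      intro τ ρ hτ hρ
      refine (sort_iff k ℓ _ _).2 ⟨isBlockPerm_inv k ℓ ρ hρ, ?_⟩
      simpa using hτ
    refine Finset.sum_bij (fun p _ => p.1 * p.2) (fun _ _ => Finset.mem_univ _) ?_ ?_ ?_
    · rintro ⟨τ, ρ⟩ h1 ⟨τ', ρ'⟩ h2 he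
      simp only [Finset.mem_product, Finset.mem_filter, Finset.mem_univ, true_and] at h1 h2 he
      have e1 := uniq τ ρ h1.1 h1.2
      have e2 := uniq τ' ρ' h2.1 h2.2
      rw [he, ← e2] at e1
      have e3 := inv_injective e1
      subst e3
      rw [mul_right_cancel he]
    · intro σ _
      obtain ⟨h1, h2⟩ := (sort_iff k ℓ σ _).1 rfl
      refine ⟨(σ * Tuple.sort (shKey k ℓ σ), (Tuple.sort (shKey k ℓ σ))⁻¹), ?_, ?_⟩
      · simp only [Finset.mem_product, Finset.mem_filter, Finset.mem_univ, true_and]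
        exact ⟨h2, isBlockPerm_inv k ℓ _ h1⟩
      · simp
    · intro p _
      rw [map_mul]
  rw [mul_smul_comm, main, ← Nat.cast_smul_eq_nsmul ℚ, smul_smul]
  congr 1
  rw [Nat.cast_choose ℚ h]
  have : (k.factorial : ℚ) ≠ 0 := by exact_mod_cast k.factorial_ne_zero
  field_simp
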